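/- arXiv:2208.14716 — 8 statements merged into one kernel-verified Lean document; each statement's English description precedes it below -/
import Mathlib

section
/- Let C be a groupoid and let X = Σ (a b : C), (a ⟶ b) be the set of all its morphisms. Define η = ε = { (a, a, 𝟙 a) : a an object of C }, and define μ : X → X → Set X by μ((y', z, g), (x, y, h)) = {(x, z, h ≫ g)} if y' = y (i.e. the source of g equals the target of h) and ∅ otherwise. Then (X, η, ε, μ) satisfies unitality, associativity, and nondegeneracy, and for each x = (a, b, f) ∈ X the unique y ∈ X with μ(x, y) ∩ ε nonempty is (b, a, inv f). -/
open CategoryTheory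

/-- The Frobenius object in Rel associated to a groupoid: the set of morphisms,
with unit and counit the identity morphisms and multiplication given by composition. -/
theorem groupoid_frobenius_in_Rel {C : Type*} [Groupoid C]
    (η ε : Set (Σ (a : C) (b : C), a ⟶ b))
    (μ : (Σ (a : C) (b : C), a ⟶ b) → (Σ (a : C) (b : C), a ⟶ b) →
      Set (Σ (a : C) (b : C), a ⟶ b))
    (hη : η = {x | ∃ a : C, x = ⟨a, a, 𝟙 a⟩})
    (hε : ε = η)
    (hμ : ∀ p q : (Σ (a : C) (b : C), a ⟶ b),
      μ p q = {r | ∃ (a b c : C) (h : a ⟶ b) (g : b ⟶ c),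
        p = ⟨b, c, g⟩ ∧ q = ⟨a, b, h⟩ ∧ r = ⟨a, c, h ≫ g⟩}) :
    -- Unitality
    ((∀ x y, (∃ e ∈ η, y ∈ μ x e) ↔ y = x) ∧
     (∀ x y, (∃ e ∈ η, y ∈ μ e x) ↔ y = x)) ∧
    -- Associativity
    (∀ x y z w, (∃ u ∈ μ x y, w ∈ μ u z) ↔ (∃ v ∈ μ y z, w ∈ μ x v)) ∧
    -- Nondegeneracy
    (∀ x, ∃! y, (μ x y ∩ ε).Nonempty) ∧
    -- The unique partner of (a, b, f) is (b, a, inv f)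
    (∀ (a b : C) (f : a ⟶ b) (y : Σ (a : C) (b : C), a ⟶ b),
      (μ ⟨a, b, f⟩ y ∩ ε).Nonempty ↔ y = ⟨b, a, Groupoid.inv f⟩) := by
  subst hε hη
  have partner_iff : ∀ (a b : C) (f : a ⟶ b) (y : Σ (a : C) (b : C), a ⟶ b),
      (μ ⟨a, b, f⟩ y ∩ {x | ∃ a : C, x = ⟨a, a, 𝟙 a⟩}).Nonempty ↔
        y = ⟨b, a, Groupoid.inv f⟩ := by
    intro a b f y
    simp only [hμ]
    constructor
    · rintro ⟨r, ⟨c, _, _, h, _, hp, rfl, rfl⟩, d, hr⟩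
      cases hp
      obtain ⟨rfl, hr⟩ := Sigma.mk.inj hr
      obtain ⟨rfl, hr⟩ := Sigma.mk.inj (eq_of_heq hr)
      have hf : h ≫ f = 𝟙 _ := eq_of_heq hr
      rw [Groupoid.inv_eq_inv, IsIso.inv_eq_of_inv_hom_id hf]
    · rintro rfl
      exact ⟨_, ⟨b, a, b, Groupoid.inv f, f, rfl, rfl, rfl⟩, b, by rw [Groupoid.inv_comp]⟩
  refine ⟨⟨?_, ?_⟩, ?_, ?_, partner_iff⟩
  · rintro ⟨a, b, f⟩ y
    simp only [hμ]
    constructor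
    · rintro ⟨_, ⟨c, rfl⟩, _, _, _, h, g, hp, hq, rfl⟩
      cases hp
      cases hq
      rw [Category.id_comp]
    · rintro rfl
      exact ⟨_, ⟨a, rfl⟩, a, a, b, 𝟙 a, f, rfl, rfl, by rw [Category.id_comp]⟩
  · rintro ⟨a, b, f⟩ y
    simp only [hμ]
    constructor
    · rintro ⟨_, ⟨c, rfl⟩, _, _, _, h, g, hp, hq, rfl⟩
      cases hp
      cases hq
      rw [Category.comp_id]
    · rintro rfl
      exact ⟨_, ⟨b, rfl⟩, a, b, b, f, 𝟙 b, rfl, rfl, by rw [Category.comp_id]⟩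
  · intro x y z w
    simp only [hμ]
    constructor
    · rintro ⟨_, ⟨b, c, d, g, k, rfl, rfl, rfl⟩, a, _, _, h, _, hp, rfl, rfl⟩
      cases hp
      exact ⟨_, ⟨a, b, c, h, g, rfl, rfl, rfl⟩, a, c, d, h ≫ g, k, rfl, rfl,
        by rw [Category.assoc]⟩
    · rintro ⟨_, ⟨a, b, c, h, g, rfl, rfl, rfl⟩, _, _, d, _, k, rfl, hq, rfl⟩
      cases hq
      exact ⟨_, ⟨b, c, d, g, k, rfl, rfl, rfl⟩, a, b, d, h, g ≫ k, rfl, rfl,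
        by rw [Category.assoc]⟩
  · rintro ⟨a, b, f⟩
    exact ⟨⟨b, a, Groupoid.inv f⟩, (partner_iff a b f _).2 rfl,
      fun y hy => (partner_iff a b f y).1 hy⟩
end

section
/- Let C be a groupoid, X = Σ (a b : C), (a ⟶ b) its set of morphisms, η = { (a, a, 𝟙 a) : a an object of C }, and μ((y', z, g), (x, y, h)) = {(x, z, h ≫ g)} if y' = y and ∅ otherwise. Let σ be a section of the target map: for each object p of C, a choice of an object c(p) and a morphism σ(p) : c(p) ⟶ p. Set ε_σ = { (c(p), p, σ(p)) : p an object of C }. Then (X, η, ε_σ, μ) satisfies unitality, associativity, and nondegeneracy, and for each x = (a, b, f) ∈ X the unique y ∈ X with μ(x, y) ∩ ε_σ nonempty is (c(b), a, σ(b) ≫ inv f). -/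
open CategoryTheory

/-- The Frobenius object in Rel associated to a groupoid with counit twisted by a
section `σ` of the target map: for each object `p`, `σ p : c p ⟶ p`. -/
theorem groupoid_twisted_counit_frobenius_in_Rel {C : Type*} [Groupoid C]
    (η ε : Set (Σ (a : C) (b : C), a ⟶ b))
    (μ : (Σ (a : C) (b : C), a ⟶ b) → (Σ (a : C) (b : C), a ⟶ b) →
      Set (Σ (a : C) (b : C), a ⟶ b))
    (c : C → C) (σ : ∀ p : C, c p ⟶ p)
    (hη : η = {x | ∃ a : C, x = ⟨a, a, 𝟙 a⟩})
    (hε : ε = {x | ∃ p : C, x = ⟨c p, p, σ p⟩})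
    (hμ : ∀ p q : (Σ (a : C) (b : C), a ⟶ b),
      μ p q = {r | ∃ (a b d : C) (h : a ⟶ b) (g : b ⟶ d),
        p = ⟨b, d, g⟩ ∧ q = ⟨a, b, h⟩ ∧ r = ⟨a, d, h ≫ g⟩}) :
    -- Unitality
    ((∀ x y, (∃ e ∈ η, y ∈ μ x e) ↔ y = x) ∧
     (∀ x y, (∃ e ∈ η, y ∈ μ e x) ↔ y = x)) ∧
    -- Associativity
    (∀ x y z w, (∃ u ∈ μ x y, w ∈ μ u z) ↔ (∃ v ∈ μ y z, w ∈ μ x v)) ∧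
    -- Nondegeneracy
    (∀ x, ∃! y, (μ x y ∩ ε).Nonempty) ∧
    -- The unique partner of (a, b, f) is (c b, a, σ b ≫ inv f)
    (∀ (a b : C) (f : a ⟶ b) (y : Σ (a : C) (b : C), a ⟶ b),
      (μ ⟨a, b, f⟩ y ∩ ε).Nonempty ↔ y = ⟨c b, a, σ b ≫ Groupoid.inv f⟩) := by
  have mem_comp : ∀ {a b d : C} (h : a ⟶ b) (g : b ⟶ d),
      (⟨a, d, h ≫ g⟩ : Σ (a : C) (b : C), a ⟶ b) ∈ μ ⟨b, d, g⟩ ⟨a, b, h⟩ := by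
    intro a b d h g
    rw [hμ]
    exact ⟨a, b, d, h, g, rfl, rfl, rfl⟩
  have partner : ∀ (a b : C) (f : a ⟶ b) (y : Σ (a : C) (b : C), a ⟶ b),
      (μ ⟨a, b, f⟩ y ∩ ε).Nonempty ↔ y = ⟨c b, a, σ b ≫ Groupoid.inv f⟩ := by
    intro a b f y
    constructor
    · rintro ⟨r, hr, hrε⟩
      rw [hμ] at hr
      rw [hε] at hrε
      obtain ⟨a', b', d', h, g, hf, rfl, rfl⟩ := hr
      obtain ⟨p, hp⟩ := hrε
      cases hf
      obtain ⟨rfl, hp⟩ := Sigma.mk.inj hp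
      obtain ⟨rfl, hp⟩ := Sigma.mk.inj (eq_of_heq hp)
      rw [← eq_of_heq hp]
      simp
    · rintro rfl
      refine ⟨_, mem_comp _ _, ?_⟩
      rw [hε]
      exact ⟨b, by simp⟩
  refine ⟨⟨fun x y => ⟨?_, ?_⟩, fun x y => ⟨?_, ?_⟩⟩, fun x y z w => ⟨?_, ?_⟩, ?_, partner⟩
  · rintro ⟨e, he, hy⟩
    rw [hη] at he
    rw [hμ] at hy
    obtain ⟨a', rfl⟩ := he
    obtain ⟨a, b, d, h, g, rfl, he, rfl⟩ := hy
    cases he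
    simp
  · rintro rfl
    obtain ⟨a, b, f⟩ := y
    exact ⟨⟨a, a, 𝟙 a⟩, hη ▸ ⟨a, rfl⟩, by simpa using mem_comp (𝟙 a) f⟩
  · rintro ⟨e, he, hy⟩
    rw [hη] at he
    rw [hμ] at hy
    obtain ⟨a', rfl⟩ := he
    obtain ⟨a, b, d, h, g, he, rfl, rfl⟩ := hy
    cases he
    simp
  · rintro rfl
    obtain ⟨a, b, f⟩ := y
    exact ⟨⟨b, b, 𝟙 b⟩, hη ▸ ⟨b, rfl⟩, by simpa using mem_comp f (𝟙 b)⟩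
  · rintro ⟨u, hu, hw⟩
    rw [hμ] at hu hw
    obtain ⟨a, b, d, h, g, rfl, rfl, rfl⟩ := hu
    obtain ⟨a', b', d', k, l, hl, rfl, rfl⟩ := hw
    cases hl
    exact ⟨_, mem_comp k h, by simpa using mem_comp (k ≫ h) g⟩
  · rintro ⟨v, hv, hw⟩
    rw [hμ] at hv hw
    obtain ⟨a, b, d, h, g, rfl, rfl, rfl⟩ := hv
    obtain ⟨a', b', d', k, l, rfl, hk, rfl⟩ := hw
    cases hk
    exact ⟨_, mem_comp g l, by simpa using mem_comp h (g ≫ l)⟩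
  · rintro ⟨a, b, f⟩
    exact ⟨_, (partner a b f _).2 rfl, fun y hy => (partner a b f y).1 hy⟩
end

section
/- Let G be a group and let X be the set of conjugacy classes of G. Set η = ε = {[1]}, the singleton of the conjugacy class of the identity, and define μ : X → X → Set X by μ(C₁, C₂) = { C₃ : there exist g₁, g₂ ∈ G with [g₁] = C₁, [g₂] = C₂, and [g₁ g₂] = C₃ }. Then (X, η, ε, μ) satisfies unitality, associativity, and nondegeneracy, and for each conjugacy class [g] the unique y ∈ X with μ([g], y) ∩ ε nonempty is [g⁻¹]. -/
namespace ConjClasses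

variable {G : Type*} [Group G]

theorem mk_conj_eq (k a : G) : ConjClasses.mk (k * a * k⁻¹) = ConjClasses.mk a :=
  mk_eq_mk_iff_isConj.2 (isConj_iff.2 ⟨k⁻¹, by group⟩)

theorem mk_eq_mk_one_iff {a : G} : ConjClasses.mk a = ConjClasses.mk 1 ↔ a = 1 := by
  rw [mk_eq_mk_iff_isConj, isConj_one_left]

/-- If a class is that of a product, every representative of it is a product of
representatives of the classes of the factors. -/
theorem exists_mul_eq_of_mk_eq_mk_mul {a b c : G}
    (h : ConjClasses.mk c = ConjClasses.mk (a * b)) :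
    ∃ a' b' : G, ConjClasses.mk a' = ConjClasses.mk a ∧
      ConjClasses.mk b' = ConjClasses.mk b ∧ a' * b' = c := by
  obtain ⟨k, rfl⟩ := isConj_iff.1 (mk_eq_mk_iff_isConj.1 h.symm)
  exact ⟨k * a * k⁻¹, k * b * k⁻¹, mk_conj_eq k a, mk_conj_eq k b, by group⟩

theorem exists_mul_eq_one_iff {g : G} {y : ConjClasses G} :
    (∃ g₁ g₂ : G, ConjClasses.mk g₁ = ConjClasses.mk g ∧ ConjClasses.mk g₂ = y ∧
      g₁ * g₂ = 1) ↔ y = ConjClasses.mk g⁻¹ := by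
  constructor
  · rintro ⟨a, b, ha, rfl, hab⟩
    obtain ⟨k, rfl⟩ := isConj_iff.1 (mk_eq_mk_iff_isConj.1 ha.symm)
    rw [← mk_conj_eq k g⁻¹, eq_inv_of_mul_eq_one_right hab]
    congr 1
    group
  · rintro rfl
    exact ⟨g, g⁻¹, rfl, rfl, mul_inv_cancel g⟩

end ConjClasses


/-- The set of conjugacy classes of a group is a Frobenius object in Rel, with unit
and counit the class of the identity, and multiplication relating `(C₁, C₂)` to every
class containing a product of an element of `C₁` with an element of `C₂`. -/
theorem conj_classes_frobenius_in_Rel {G : Type*} [Group G]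
    (η ε : Set (ConjClasses G))
    (μ : ConjClasses G → ConjClasses G → Set (ConjClasses G))
    (hη : η = {ConjClasses.mk (1 : G)})
    (hε : ε = {ConjClasses.mk (1 : G)})
    (hμ : ∀ C₁ C₂, μ C₁ C₂ = {C₃ | ∃ g₁ g₂ : G,
      ConjClasses.mk g₁ = C₁ ∧ ConjClasses.mk g₂ = C₂ ∧ ConjClasses.mk (g₁ * g₂) = C₃}) :
    -- Unitality
    ((∀ x y, (∃ e ∈ η, y ∈ μ x e) ↔ y = x) ∧
     (∀ x y, (∃ e ∈ η, y ∈ μ e x) ↔ y = x)) ∧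
    -- Associativity
    (∀ x y z w, (∃ u ∈ μ x y, w ∈ μ u z) ↔ (∃ v ∈ μ y z, w ∈ μ x v)) ∧
    -- Nondegeneracy
    (∀ x, ∃! y, (μ x y ∩ ε).Nonempty) ∧
    -- The unique partner of [g] is [g⁻¹]
    (∀ (g : G) (y : ConjClasses G),
      (μ (ConjClasses.mk g) y ∩ ε).Nonempty ↔ y = ConjClasses.mk g⁻¹) := by
  obtain rfl : μ = _ := funext₂ hμ
  subst hη hε
  have partner : ∀ (g : G) (y : ConjClasses G), (({C₃ | ∃ g₁ g₂ : G,
      ConjClasses.mk g₁ = ConjClasses.mk g ∧ ConjClasses.mk g₂ = y ∧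
      ConjClasses.mk (g₁ * g₂) = C₃} : Set (ConjClasses G)) ∩
      {ConjClasses.mk 1}).Nonempty ↔ y = ConjClasses.mk g⁻¹ := fun g y => by
    rw [Set.inter_singleton_nonempty, ← ConjClasses.exists_mul_eq_one_iff]
    simp only [Set.mem_ofPred_eq, ConjClasses.mk_eq_mk_one_iff]
  refine ⟨⟨fun x y => ?_, fun x y => ?_⟩, fun x y z w => ⟨?_, ?_⟩, fun x => ?_, partner⟩
  · constructor
    · rintro ⟨_, rfl, a, b, rfl, hb, rfl⟩
      rw [ConjClasses.mk_eq_mk_one_iff.1 hb, mul_one]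
    · rintro rfl
      obtain ⟨a, rfl⟩ := ConjClasses.exists_rep y
      exact ⟨_, rfl, a, 1, rfl, rfl, by rw [mul_one]⟩
  · constructor
    · rintro ⟨_, rfl, a, b, ha, rfl, rfl⟩
      rw [ConjClasses.mk_eq_mk_one_iff.1 ha, one_mul]
    · rintro rfl
      obtain ⟨a, rfl⟩ := ConjClasses.exists_rep y
      exact ⟨_, rfl, 1, a, rfl, rfl, by rw [one_mul]⟩
  · rintro ⟨_, ⟨a, b, rfl, rfl, rfl⟩, d, c, hd, rfl, rfl⟩
    obtain ⟨a', b', ha, hb, rfl⟩ := ConjClasses.exists_mul_eq_of_mk_eq_mk_mul hd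
    exact ⟨_, ⟨b', c, hb, rfl, rfl⟩, a', b' * c, ha, rfl, by rw [mul_assoc]⟩
  · rintro ⟨_, ⟨b, c, rfl, rfl, rfl⟩, a, d, rfl, hd, rfl⟩
    obtain ⟨b', c', hb, hc, rfl⟩ := ConjClasses.exists_mul_eq_of_mk_eq_mk_mul hd
    exact ⟨_, ⟨a, b', rfl, hb, rfl⟩, a * b', c', rfl, hc, by rw [mul_assoc]⟩
  · obtain ⟨g, rfl⟩ := ConjClasses.exists_rep x
    exact ⟨_, (partner g _).2 rfl, fun y => (partner g y).1⟩
end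

section
/- Let G be a finite abelian group (written additively) and fix ω ∈ G. Consider the Frobenius object in Rel given by X = G, η = {0}, ε = {ω}, μ x y = {x + y}, with nondegeneracy bijection α̂ x = ω − x. Define S : G → Set G by S x = ⋃_{y ∈ G} ⋃_{z ∈ μ y x} μ (α̂ y) z, and define subsets S^g∘η of G recursively by S^0∘η = η and S^{g+1}∘η = ⋃_{x ∈ S^g∘η} S x. Then for every natural number g, (S^g∘η) ∩ ε is nonempty if and only if g • ω = ω (equivalently, (g − 1) • ω = 0). -/
/-- The partition function of the Frobenius object in Rel given by a finite abelian
group `G` with counit `{ω}`: the genus-`g` invariant is `True` iff `g • ω = ω`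
(equivalently, `(g - 1) • ω = 0`). -/
theorem partition_function_abelian_group {G : Type*} [AddCommGroup G] [Fintype G]
    (ω : G)
    (η ε : Set G) (μ : G → G → Set G) (α : G → G)
    (hη : η = {(0 : G)}) (hε : ε = {ω})
    (hμ : ∀ x y, μ x y = {x + y})
    (hα : ∀ x, α x = ω - x)
    (S : G → Set G)
    (hS : ∀ x, S x = ⋃ y : G, ⋃ z ∈ μ y x, μ (α y) z)
    (Sg : ℕ → Set G)
    (hSg0 : Sg 0 = η)
    (hSgsucc : ∀ g : ℕ, Sg (g + 1) = ⋃ x ∈ Sg g, S x) :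
    ∀ g : ℕ, (Sg g ∩ ε).Nonempty ↔ g • ω = ω := by
  have hS' : ∀ x, S x = {ω + x} := by
    intro x
    have h : ∀ y : G, ω - y + (y + x) = ω + x := fun y => by abel
    simp only [hS, hμ, hα, Set.biUnion_singleton, h, Set.iUnion_const]
  have hSg : ∀ g : ℕ, Sg g = {g • ω} := by
    intro g
    induction g with
    | zero => rw [hSg0, hη, zero_smul]
    | succ g ih => rw [hSgsucc, ih, Set.biUnion_singleton, hS', succ_nsmul']
  intro g
  rw [hSg, hε, Set.singleton_inter_nonempty, Set.mem_singleton_iff]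
end

section
/- Let (X, η, ε, μ) be a Frobenius object in Rel (satisfying unitality, associativity, and nondegeneracy) that is commutative (μ x y = μ y x for all x, y), with nondegeneracy bijection α̂ sending each x to the unique y with μ x y ∩ ε nonempty. Define S : X → Set X by S x = ⋃_{y ∈ X} ⋃_{z ∈ μ y x} μ (α̂ y) z, and subsets S^g∘η of X recursively by S^0∘η = η and S^{g+1}∘η = ⋃_{x ∈ S^g∘η} S x. If η ∩ ε is nonempty, then (S^g∘η) ∩ ε is nonempty for every natural number g. -/
/-- For a commutative Frobenius object in Rel whose unit and counit intersect,
the partition function is identically `True`: `(S^g ∘ η) ∩ ε` is nonempty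
for every genus `g`. -/
theorem partition_function_true_of_unit_counit_intersect {X : Type*}
    (η ε : Set X) (μ : X → X → Set X) (α : X → X)
    -- Unitality
    (hU1 : ∀ x y, (∃ e ∈ η, y ∈ μ x e) ↔ y = x)
    (hU2 : ∀ x y, (∃ e ∈ η, y ∈ μ e x) ↔ y = x)
    -- Associativity
    (hA : ∀ x y z w, (∃ u ∈ μ x y, w ∈ μ u z) ↔ (∃ v ∈ μ y z, w ∈ μ x v))
    -- Nondegeneracy, with nondegeneracy bijection α
    (hN : ∀ x y, (μ x y ∩ ε).Nonempty ↔ y = α x)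
    -- Commutativity
    (hC : ∀ x y, μ x y = μ y x)
    (S : X → Set X)
    (hS : ∀ x, S x = ⋃ y : X, ⋃ z ∈ μ y x, μ (α y) z)
    (Sg : ℕ → Set X)
    (hSg0 : Sg 0 = η)
    (hSgsucc : ∀ g : ℕ, Sg (g + 1) = ⋃ x ∈ Sg g, S x) :
    (η ∩ ε).Nonempty → ∀ g : ℕ, (Sg g ∩ ε).Nonempty := by
  rintro ⟨e, heη, heε⟩ g
  have he : e ∈ μ e e := by
    obtain ⟨e', he'η, h⟩ := (hU1 e e).2 rfl
    obtain rfl : e = e' := (hU2 e' e).1 ⟨e, heη, h⟩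
    exact h
  have hα : e = α e := (hN e e).1 ⟨e, he, heε⟩
  have heS : e ∈ S e := by
    simp only [hS, Set.mem_iUnion]
    exact ⟨e, e, he, hα ▸ he⟩
  refine ⟨e, ?_, heε⟩
  induction g with
  | zero => exact hSg0 ▸ heη
  | succ g ih =>
    rw [hSgsucc]
    exact Set.mem_biUnion ih heS
end

section
/- Let X be a set, η ⊆ X, and μ : X → X → Set X satisfying unitality: for all x, y ∈ X, (∃ e ∈ η, y ∈ μ x e) ↔ y = x, and (∃ e ∈ η, y ∈ μ e x) ↔ y = x. Then for every e ∈ η, μ e e = {e}. -/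
/-- If `(X, η, μ)` satisfies the unitality axiom of a Frobenius object in Rel,
then `μ e e = {e}` for every `e ∈ η`. -/
theorem mul_unit_unit_eq_singleton {X : Type*}
    (η : Set X) (μ : X → X → Set X)
    (hU1 : ∀ x y, (∃ e ∈ η, y ∈ μ x e) ↔ y = x)
    (hU2 : ∀ x y, (∃ e ∈ η, y ∈ μ e x) ↔ y = x) :
    ∀ e ∈ η, μ e e = {e} := by
  intro e he
  ext y
  rw [Set.mem_singleton_iff]
  refine ⟨fun hy => (hU1 e y).1 ⟨e, he, hy⟩, ?_⟩
  rintro rfl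
  obtain ⟨f, -, hf⟩ := (hU1 y y).2 rfl
  obtain rfl : y = f := (hU2 f y).1 ⟨y, he, hf⟩
  exact hf
end

section
/- Let (η, ε, μ) be a Frobenius object structure on X = Fin 2 = {0, 1} (satisfying unitality, associativity, and nondegeneracy). Then (η, ε, μ) is isomorphic — via a bijection φ : Fin 2 → Fin 2 with φ(η), φ(ε), and the transported multiplication (x, y) ↦ φ(μ(φ⁻¹x, φ⁻¹y)) equal to the target data — to exactly one of the following five structures, all of which have μ(0,0) = {0}, μ(0,1) = μ(1,0) = {1} except case (5): (1) η = ε = {0}, μ(1,1) = {0}; (2) η = ε = {0}, μ(1,1) = {0,1}; (3) η = {0}, ε = {1}, μ(1,1) = {0}; (4) η = {0}, ε = {1}, μ(1,1) = ∅; (5) η = ε = {0,1}, μ(0,0) = {0}, μ(1,1) = {1}, μ(0,1) = μ(1,0) = ∅. Moreover, no two distinct structures among these five are isomorphic. -/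
/-- Data of a candidate Frobenius object in Rel on a type `X`: unit, counit and
multiplication relation. -/
structure FrobData (X : Type*) where
  unit : Set X
  counit : Set X
  mul : X → X → Set X

/-- The axioms of a Frobenius object in Rel: unitality, associativity,
nondegeneracy. -/
def IsFrobenius {X : Type*} (A : FrobData X) : Prop :=
  (∀ x y, (∃ e ∈ A.unit, y ∈ A.mul x e) ↔ y = x) ∧
  (∀ x y, (∃ e ∈ A.unit, y ∈ A.mul e x) ↔ y = x) ∧
  (∀ x y z w, (∃ u ∈ A.mul x y, w ∈ A.mul u z) ↔ (∃ v ∈ A.mul y z, w ∈ A.mul x v)) ∧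
  (∀ x, ∃! y, (A.mul x y ∩ A.counit).Nonempty)

/-- Isomorphism of Frobenius data: a bijection carrying unit to unit, counit to
counit, and multiplication to multiplication. -/
def FrobIso {X Y : Type*} (A : FrobData X) (B : FrobData Y) : Prop :=
  ∃ φ : X ≃ Y, φ '' A.unit = B.unit ∧ φ '' A.counit = B.counit ∧
    ∀ x y, φ '' A.mul x y = B.mul (φ x) (φ y)

/-- The multiplication table on `Fin 2` with `μ(0,0) = {0}`, `μ(0,1) = μ(1,0) = {1}`
and `μ(1,1) = s`. -/
def twoMul (s : Set (Fin 2)) : Fin 2 → Fin 2 → Set (Fin 2) := fun x y =>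
  if x = 0 then (if y = 0 then {0} else {1})
  else (if y = 0 then {1} else s)

/-- The five two-element Frobenius objects in Rel. -/
def twoElemCase : Fin 5 → FrobData (Fin 2) :=
  ![⟨{0}, {0}, twoMul {0}⟩,
    ⟨{0}, {0}, twoMul {0, 1}⟩,
    ⟨{0}, {1}, twoMul {0}⟩,
    ⟨{0}, {1}, twoMul ∅⟩,
    ⟨{0, 1}, {0, 1}, fun x y => if x = y then {x} else ∅⟩]

theorem FrobIso.symm {X Y : Type*} {A : FrobData X} {B : FrobData Y} (h : FrobIso A B) :
    FrobIso B A := by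
  obtain ⟨φ, hη, hε, hμ⟩ := h
  refine ⟨φ.symm, ?_, ?_, fun x y => ?_⟩
  · rw [← hη, Equiv.symm_image_image]
  · rw [← hε, Equiv.symm_image_image]
  · rw [← φ.apply_symm_apply x, ← φ.apply_symm_apply y, ← hμ, Equiv.symm_image_image]
    simp

theorem FrobIso.trans {X Y Z : Type*} {A : FrobData X} {B : FrobData Y} {C : FrobData Z}
    (h : FrobIso A B) (k : FrobIso B C) : FrobIso A C := by
  obtain ⟨φ, hη, hε, hμ⟩ := h
  obtain ⟨ψ, kη, kε, kμ⟩ := k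
  refine ⟨φ.trans ψ, ?_, ?_, fun x y => ?_⟩
  · rw [← kη, ← hη, ← Set.image_comp]; rfl
  · rw [← kε, ← hε, ← Set.image_comp]; rfl
  · rw [Equiv.trans_apply, Equiv.trans_apply, ← kμ, ← hμ, ← Set.image_comp]; rfl

theorem FrobIso.refl {X : Type*} (A : FrobData X) : FrobIso A A :=
  ⟨Equiv.refl X, by simp, by simp, by simp⟩

/-- The structure on `X` transported along a permutation of `X`. -/
def FrobData.transport {X : Type*} (A : FrobData X) (φ : Equiv.Perm X) : FrobData X where
  unit := φ '' A.unit
  counit := φ '' A.counit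
  mul x y := φ '' A.mul (φ.symm x) (φ.symm y)

theorem FrobData.frobIso_transport {X : Type*} (A : FrobData X) (φ : Equiv.Perm X) :
    FrobIso A (A.transport φ) :=
  ⟨φ, rfl, rfl, fun x y => by simp [FrobData.transport]⟩

theorem Equiv.Perm.fin_two_eq (φ : Equiv.Perm (Fin 2)) : φ = 1 ∨ φ = Equiv.swap 0 1 := by
  revert φ
  decide

theorem Set.fin_two_cases (s : Set (Fin 2)) : s = ∅ ∨ s = {0} ∨ s = {1} ∨ s = {0, 1} := by
  by_cases h0 : (0 : Fin 2) ∈ s <;> by_cases h1 : (1 : Fin 2) ∈ s <;>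
    simp [Set.ext_iff, Fin.forall_fin_two, h0, h1]

theorem FrobIso.twoElemCase_injective {i j : Fin 5}
    (h : FrobIso (twoElemCase i) (twoElemCase j)) : i = j := by
  obtain ⟨φ, hη, hε, hμ⟩ := h
  have h11 := hμ 1 1
  obtain rfl | rfl := Equiv.Perm.fin_two_eq φ <;> fin_cases i <;> fin_cases j <;>
    first
    | rfl
    | (exfalso
       simp [twoElemCase, twoMul, Set.ext_iff, Fin.forall_fin_two] at hη hε h11)

theorem IsFrobenius.transport {X : Type*} {A : FrobData X} (h : IsFrobenius A)
    (φ : Equiv.Perm X) : IsFrobenius (A.transport φ) := by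
  obtain ⟨hr, hl, ha, hn⟩ := h
  refine ⟨fun x y => ?_, fun x y => ?_, fun x y z w => ?_, fun x => ?_⟩
  · simp only [FrobData.transport, Set.exists_mem_image]
    simpa [Set.mem_image_equiv] using hr (φ.symm x) (φ.symm y)
  · simp only [FrobData.transport, Set.exists_mem_image]
    simpa [Set.mem_image_equiv] using hl (φ.symm x) (φ.symm y)
  · simp only [FrobData.transport, Set.exists_mem_image]
    simpa [Set.mem_image_equiv] using ha (φ.symm x) (φ.symm y) (φ.symm z) (φ.symm w)
  · obtain ⟨y, hy, hu⟩ := hn (φ.symm x)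
    refine ⟨φ y, ?_, fun z hz => ?_⟩
    · simpa [FrobData.transport, ← Set.image_inter φ.injective] using hy
    · rw [← hu (φ.symm z) (by
        simpa [FrobData.transport, ← Set.image_inter φ.injective] using hz),
        φ.apply_symm_apply]

theorem IsFrobenius.exists_frobIso_of_zero_mem {A : FrobData (Fin 2)} (hA : IsFrobenius A)
    (h0 : 0 ∈ A.unit) : ∃ i, FrobIso A (twoElemCase i) := by
  obtain ⟨hr, hl, -, hn⟩ := hA
  suffices ∃ i, A = twoElemCase i by
    obtain ⟨i, rfl⟩ := this
    exact ⟨i, .refl _⟩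
  obtain ⟨η, ε, μ⟩ := A
  have hμ : ∀ s, (μ 0 0 = {0} ∧ μ 0 1 = {1} ∧ μ 1 0 = {1} ∧ μ 1 1 = s) → μ = twoMul s := by
    intro s ⟨h00, h01, h10, h11⟩
    ext x y : 2
    fin_cases x <;> fin_cases y <;> simp [twoMul, *]
  have hδ : (μ 0 0 = {0} ∧ μ 0 1 = ∅ ∧ μ 1 0 = ∅ ∧ μ 1 1 = {1}) →
      μ = fun x y => if x = y then {x} else ∅ := by
    intro ⟨h00, h01, h10, h11⟩
    ext x y : 2
    fin_cases x <;> fin_cases y <;> simp [*]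
  obtain rfl | rfl : η = {0} ∨ η = {0, 1} := by
    obtain rfl | rfl | rfl | rfl := η.fin_two_cases <;> simp_all
  · have h00 : μ 0 0 = {0} := Set.ext fun y => by simpa using hr 0 y
    have h01 : μ 0 1 = {1} := Set.ext fun y => by simpa using hl 1 y
    have h10 : μ 1 0 = {1} := Set.ext fun y => by simpa using hr 1 y
    obtain ⟨s, hs⟩ : ∃ s, μ 1 1 = s := ⟨_, rfl⟩
    obtain rfl := hμ s ⟨h00, h01, h10, hs⟩
    have hn0 := hn 0
    have hn1 := hn 1
    obtain rfl | rfl | rfl | rfl := ε.fin_two_cases <;>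
      obtain rfl | rfl | rfl | rfl := s.fin_two_cases <;>
      first
      | exact ⟨0, rfl⟩
      | exact ⟨1, rfl⟩
      | exact ⟨2, rfl⟩
      | exact ⟨3, rfl⟩
      | (exfalso
         simp [twoMul, ExistsUnique, Fin.forall_fin_two, Fin.exists_fin_two,
           Set.Nonempty] at hn0 hn1)
  · simp only [Set.mem_insert_iff, Set.mem_singleton_iff, Fin.forall_fin_two,
      Fin.exists_fin_two] at hr hl
    have h00 : μ 0 0 = {0} := by simp [Set.ext_iff, Fin.forall_fin_two]; grind
    have h01 : μ 0 1 = ∅ := by simp [Set.ext_iff, Fin.forall_fin_two]; grind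
    have h10 : μ 1 0 = ∅ := by simp [Set.ext_iff, Fin.forall_fin_two]; grind
    have h11 : μ 1 1 = {1} := by simp [Set.ext_iff, Fin.forall_fin_two]; grind
    obtain rfl := hδ ⟨h00, h01, h10, h11⟩
    have hn0 := hn 0
    have hn1 := hn 1
    obtain rfl | rfl | rfl | rfl := ε.fin_two_cases <;>
      first
      | exact ⟨4, rfl⟩
      | (exfalso
         simp [ExistsUnique, Set.Nonempty] at hn0 hn1)

theorem IsFrobenius.exists_frobIso {A : FrobData (Fin 2)} (hA : IsFrobenius A) :
    ∃ i, FrobIso A (twoElemCase i) := by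
  obtain ⟨e, he, -⟩ := (hA.1 0 0).2 rfl
  obtain ⟨i, hi⟩ := (hA.transport (Equiv.swap 0 e)).exists_frobIso_of_zero_mem
    ⟨e, he, Equiv.swap_apply_right 0 e⟩
  exact ⟨i, (A.frobIso_transport _).trans hi⟩

/-- Classification: every Frobenius object in Rel on a two-element set is isomorphic
to exactly one of the five listed structures, and no two distinct structures among
the five are isomorphic. -/
theorem two_element_classification :
    (∀ A : FrobData (Fin 2), IsFrobenius A → ∃! i : Fin 5, FrobIso A (twoElemCase i)) ∧
    (∀ i j : Fin 5, FrobIso (twoElemCase i) (twoElemCase j) → i = j) := by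
  refine ⟨fun A hA => ?_, fun i j h => h.twoElemCase_injective⟩
  obtain ⟨i, hi⟩ := hA.exists_frobIso
  exact ⟨i, hi, fun j hj => (hj.symm.trans hi).twoElemCase_injective⟩
end

section
/- On X = Fin 2 = {0, 1}, define η = {0}, ε = {1}, and μ : X → X → Set X by μ(0,0) = {0}, μ(0,1) = μ(1,0) = {1}, μ(1,1) = ∅. Then: (a) (X, η, ε, μ) satisfies unitality, associativity, and nondegeneracy, and is commutative; (b) with α̂ the nondegeneracy bijection (here α̂(0) = 1 and α̂(1) = 0), S : X → Set X defined by S x = ⋃_{y ∈ X} ⋃_{z ∈ μ y x} μ (α̂ y) z, and S^0∘η = η, S^{g+1}∘η = ⋃_{x ∈ S^g∘η} S x, one has: (S^g∘η) ∩ ε is nonempty if and only if g = 1. -/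
/-- Case 4 of the two-element classification: `η = {0}`, `ε = {1}`, `μ(1,1) = ∅`.
It is a commutative Frobenius object in Rel, and its partition function is
`True` exactly for genus `g = 1`. -/
theorem two_element_case4_partition_function
    (η ε : Set (Fin 2)) (μ : Fin 2 → Fin 2 → Set (Fin 2)) (α : Fin 2 → Fin 2)
    (hη : η = {0}) (hε : ε = {1})
    (h00 : μ 0 0 = {0}) (h01 : μ 0 1 = {1}) (h10 : μ 1 0 = {1})
    (h11 : μ 1 1 = ∅)
    -- α is the nondegeneracy bijection (here α 0 = 1 and α 1 = 0)
    (hα : ∀ x y, (μ x y ∩ ε).Nonempty ↔ y = α x)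
    (S : Fin 2 → Set (Fin 2))
    (hS : ∀ x, S x = ⋃ y : Fin 2, ⋃ z ∈ μ y x, μ (α y) z)
    (Sg : ℕ → Set (Fin 2))
    (hSg0 : Sg 0 = η)
    (hSgsucc : ∀ g : ℕ, Sg (g + 1) = ⋃ x ∈ Sg g, S x) :
    -- (a) Frobenius object axioms and commutativity
    (((∀ x y, (∃ e ∈ η, y ∈ μ x e) ↔ y = x) ∧
      (∀ x y, (∃ e ∈ η, y ∈ μ e x) ↔ y = x)) ∧
     (∀ x y z w, (∃ u ∈ μ x y, w ∈ μ u z) ↔ (∃ v ∈ μ y z, w ∈ μ x v)) ∧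
     (∀ x, ∃! y, (μ x y ∩ ε).Nonempty) ∧
     (∀ x y, μ x y = μ y x) ∧
     α 0 = 1 ∧ α 1 = 0) ∧
    -- (b) the partition function is "g = 1"
    (∀ g : ℕ, (Sg g ∩ ε).Nonempty ↔ g = 1) := by
  subst hη hε
  have hα0 : α 0 = 1 := ((hα 0 1).1 (by simp [h01])).symm
  have hα1 : α 1 = 0 := ((hα 1 0).1 (by simp [h10])).symm
  have hS0 : S 0 = {1} := by ext; simp [hS, Fin.exists_fin_two, h00, h01, h10, hα0, hα1]
  have hS1 : S 1 = ∅ := by ext; simp [hS, Fin.exists_fin_two, h01, h11, hα0]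
  have hSg1 : Sg 1 = {1} := by simp [hSgsucc 0, hSg0, hS0]
  have hSg_empty (n : ℕ) : Sg (n + 2) = ∅ := by
    induction n with
    | zero => simp [hSgsucc 1, hSg1, hS1]
    | succ n ih => simp [hSgsucc (n + 2), ih]
  refine ⟨⟨⟨?_, ?_⟩, ?_, fun x => ⟨α x, (hα x _).2 rfl, fun y => (hα x y).1⟩, ?_, hα0, hα1⟩, ?_⟩
  · simp [Fin.forall_fin_two, h00, h10]
  · simp [Fin.forall_fin_two, h00, h01]
  · simp [Fin.forall_fin_two, h00, h01, h10, h11]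
  · simp [Fin.forall_fin_two, h01, h10]
  · rintro (_ | _ | n)
    · simp [hSg0]
    · simp [hSg1]
    · simp [hSg_empty]
end
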